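/- Let F be a finite field with q elements, q odd, and suppose q ≡ 1 (mod 4). Let Q be the set of nonzero squares in F and Q̄ the set of nonzero non-squares. Then for every x ∈ Q̄, the set Q̄ ∩ (Q̄ − x) = {y ∈ Q̄ : y + x ∈ Q̄} has exactly (q − 5)/4 elements. -/

import Mathlib

theorem sum_quadraticChar_mul_quadraticChar_add {F : Type*} [Field F] [Fintype F] [DecidableEq F]
    (hF : ringChar F ≠ 2) {x : F} (hx : x ≠ 0) :
    ∑ y : F, quadraticChar F y * quadraticChar F (y + x) = -1 := by
  have hJ := jacobiSum_nontrivial_inv (quadraticChar_ne_one hF)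
  rw [(quadraticChar_isQuadratic F).inv, jacobiSum] at hJ
  have hm : ∀ t : F, quadraticChar F (-x * t) * quadraticChar F (-x * t + x) =
      quadraticChar F (-1) * (quadraticChar F t * quadraticChar F (1 - t)) := by
    intro t
    have h1 : -x * t + x = x * (1 - t) := by ring
    have h2 : -x * t = -1 * x * t := by ring
    rw [h1, h2]
    simp only [map_mul]
    linear_combination quadraticChar F (-1) * quadraticChar F t * quadraticChar F (1 - t) *
      quadraticChar_sq_one hx
  rw [← Equiv.sum_comp (Equiv.mulLeft₀ (-x) (neg_ne_zero.mpr hx))]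
  simp only [Equiv.mulLeft₀_apply, hm]
  rw [← Finset.mul_sum, hJ]
  linear_combination -quadraticChar_sq_one (F := F) (neg_ne_zero.mpr one_ne_zero)

theorem four_mul_card_quadraticChar_eq_neg_one_add {F : Type*} [Field F] [Fintype F]
    [DecidableEq F] (hF : ringChar F ≠ 2) (h1 : quadraticChar F (-1) = 1) {x : F}
    (hx : quadraticChar F x = -1) :
    4 * ((Finset.univ.filter fun y : F =>
      quadraticChar F y = -1 ∧ quadraticChar F (y + x) = -1).card : ℤ) = Fintype.card F - 5 := by
  have hx0 : x ≠ 0 := by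
    rintro rfl
    simp at hx
  have hneg : quadraticChar F (-x) = -1 := by
    rw [← neg_one_mul, map_mul, h1, hx, one_mul]
  have hpt : ∀ y : F, (1 - quadraticChar F y) * (1 - quadraticChar F (y + x)) =
      4 * (if quadraticChar F y = -1 ∧ quadraticChar F (y + x) = -1 then 1 else 0) +
        (if y = 0 then 2 else 0) + (if y = -x then 2 else 0) := by
    intro y
    by_cases hy : y = 0
    · subst hy
      simp [hx, hx0]
    by_cases hyx : y = -x
    · subst hyx
      simp [hneg, hx0]
    have hyx' : y + x ≠ 0 := fun h => hyx (eq_neg_of_add_eq_zero_left h)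
    rcases quadraticChar_dichotomy hy with h | h <;>
      rcases quadraticChar_dichotomy hyx' with h' | h' <;> simp [h, h', hy, hyx]
  have hshift : ∑ y : F, quadraticChar F (y + x) = 0 := by
    rw [← quadraticChar_sum_zero hF]
    exact Equiv.sum_comp (Equiv.addRight x) (fun y => quadraticChar F y)
  have hsum : ∑ y : F, (1 - quadraticChar F y) * (1 - quadraticChar F (y + x)) =
      Fintype.card F - 1 := by
    have hexp : ∀ y : F, (1 - quadraticChar F y) * (1 - quadraticChar F (y + x)) =
        1 - quadraticChar F y - quadraticChar F (y + x) +
          quadraticChar F y * quadraticChar F (y + x) := fun y => by ring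
    simp only [hexp, Finset.sum_add_distrib, Finset.sum_sub_distrib, hshift,
      quadraticChar_sum_zero hF, sum_quadraticChar_mul_quadraticChar_add hF hx0]
    simp
    ring
  simp only [hpt, Finset.sum_add_distrib, ← Finset.mul_sum, Finset.sum_boole,
    Finset.sum_ite_eq', Finset.mem_univ, if_true] at hsum
  linarith

theorem stmt_1 (F : Type*) [Field F] [Fintype F] (q : ℕ)
    (hq : Fintype.card F = q) (hodd : Odd q) (h4 : q % 4 = 1)
    (Q Qbar : Set F)
    (hQ : Q = {x : F | x ≠ 0 ∧ ∃ y : F, y ≠ 0 ∧ x = y ^ 2})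
    (hQbar : Qbar = {x : F | x ≠ 0 ∧ x ∉ Q})
    (x : F) (hx : x ∈ Qbar) :
    ({y : F | y ∈ Qbar ∧ y + x ∈ Qbar}).ncard = (q - 5) / 4 := by
  classical
  have hF : ringChar F ≠ 2 := fun h => by
    have := FiniteField.even_card_of_char_two h
    omega
  have h1 : quadraticChar F (-1) = 1 := by
    rw [quadraticChar_one_iff_isSquare (neg_ne_zero.mpr one_ne_zero),
      FiniteField.isSquare_neg_one_iff]
    omega
  have hmem : ∀ z : F, z ∈ Qbar ↔ quadraticChar F z = -1 := by
    intro z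
    rw [quadraticChar_neg_one_iff_not_isSquare, hQbar, hQ]
    simp only [Set.mem_ofPred_eq, isSquare_iff_exists_sq]
    constructor
    · rintro ⟨hz, hn⟩ ⟨y, rfl⟩
      exact hn ⟨hz, y, fun h => hz (by simp [h]), rfl⟩
    · intro hn
      exact ⟨fun h => hn ⟨0, by simp [h]⟩, fun ⟨_, y, _, h⟩ => hn ⟨y, h⟩⟩
  have hcard := four_mul_card_quadraticChar_eq_neg_one_add hF h1 ((hmem x).mp hx)
  have hset : {y : F | y ∈ Qbar ∧ y + x ∈ Qbar} = ((Finset.univ.filter fun y : F =>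
      quadraticChar F y = -1 ∧ quadraticChar F (y + x) = -1 : Finset F) : Set F) := by
    ext y
    simp [hmem]
  rw [hset, Set.ncard_coe_finset]
  omega
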